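/- Let P^{γαβ} (γ,α,β ∈ {0,1,2}) be constants satisfying the null condition. Then there exist functions g(t,x) and h^{I₁,I₂,α}(t,x) (for multi-indices |I₁| = 1, |I₂| ≤ 1 and α ∈ {0,1,2}), defined on the cone K, such that for all sufficiently smooth functions u, v supported in K: P^{γαβ}∂_γv ∂_α∂_βu = g(t,x) ∂_tv ∂_t∂_tu + (1/t) Σ_{|I₁|=1, |I₂|≤1, α} h^{I₁,I₂,α}(t,x) Γ^{I₁}v ∂_αΓ^{I₂}u on K, where |g(t,x)| ≲ s²/t² (with s = √(t²−|x|²)), and |Γ^I(g(t,x))| ≲ 1 and |Γ^I(h^{I₁,I₂,α}(t,x))| ≲ 1 on K for every multi-index I. In particular, |P^{γαβ}∂_γv ∂_α∂_βu| ≲ (s²/t²)|∂_tv ∂_t∂_tu| + (1/t) Σ_{|I₁|=1, |I₂|≤1} |Γ^{I₁}v||∂Γ^{I₂}u| on K. -/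

import Mathlib

open MeasureTheory Real Filter Topology
open scoped ENNReal NNReal

noncomputable section

/-- A spacetime point in `ℝ^{1+2}`: coordinates `(x₀, x₁, x₂)` with `t = x₀`. -/
abbrev Pt : Type := Fin 3 → ℝ

/-- The `i`-th standard basis vector of `ℝ^{1+2}`. -/
def e3 (i : Fin 3) : Pt := Pi.single i 1

/-- Partial derivative `∂_i`. -/
def pd (i : Fin 3) (u : Pt → ℝ) : Pt → ℝ := fun p => fderiv ℝ u p (e3 i)

/-- Spatial radius `r = |x|`. -/
def rad (p : Pt) : ℝ := Real.sqrt ((p 1) ^ 2 + (p 2) ^ 2)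

/-- Hyperbolic time `s = √(t² − |x|²)`. -/
def sVar (p : Pt) : ℝ := Real.sqrt ((p 0) ^ 2 - (p 1) ^ 2 - (p 2) ^ 2)

/-- The cone `K = {(t,x) : t ≥ 2, |x| < t − 1}`. -/
def Cone : Set Pt := {p | 2 ≤ p 0 ∧ rad p < p 0 - 1}

/-- Lorentz boost `L_a = x_a ∂_t + t ∂_a`, `a ∈ {1,2}`. -/
def Lb (a : Fin 2) (u : Pt → ℝ) : Pt → ℝ :=
  fun p => p a.succ * pd 0 u p + p 0 * pd a.succ u p

/-- Semi-hyperboloidal derivative `∂̲_a = (x_a/t)∂_t + ∂_a`. -/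
def dund (a : Fin 2) (u : Pt → ℝ) : Pt → ℝ :=
  fun p => (p a.succ / p 0) * pd 0 u p + pd a.succ u p

/-- The ordered family `{Γ_k} = {∂₀, ∂₁, ∂₂, L₁, L₂}`. -/
def Gam : Fin 5 → (Pt → ℝ) → (Pt → ℝ) := ![pd 0, pd 1, pd 2, Lb 0, Lb 1]

/-- `Γ^I = Π_k Γ_k^{i_k}` for a multi-index `I ∈ ℕ⁵`. -/
def GamI (I : Fin 5 → ℕ) : (Pt → ℝ) → (Pt → ℝ) :=
  (Gam 0)^[I 0] ∘ (Gam 1)^[I 1] ∘ (Gam 2)^[I 2] ∘ (Gam 3)^[I 3] ∘ (Gam 4)^[I 4]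

/-- Length `|I|` of a multi-index. -/
def mlen (I : Fin 5 → ℕ) : ℕ := ∑ k, I k

/-- The (finite) set of multi-indices `I ∈ ℕ⁵` with `|I| ≤ n`. -/
def midxLe (n : ℕ) : Finset (Fin 5 → ℕ) :=
  (Fintype.piFinset fun _ => Finset.range (n + 1)).filter fun I => mlen I ≤ n

/-- The (finite) set of multi-indices `I ∈ ℕ⁵` with `|I| = 1`. -/
def midxEq1 : Finset (Fin 5 → ℕ) :=
  (Fintype.piFinset fun _ => Finset.range 2).filter fun I => mlen I = 1

/-- `|∂u| = (Σ_α |∂_α u|²)^{1/2}`. -/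
def pdNorm (u : Pt → ℝ) (p : Pt) : ℝ := Real.sqrt (∑ α, (pd α u p) ^ 2)

/-- The wave operator `□ = −∂_t² + ∂₁² + ∂₂²`. -/
def box (u : Pt → ℝ) : Pt → ℝ :=
  fun p => - pd 0 (pd 0 u) p + pd 1 (pd 1 u) p + pd 2 (pd 2 u) p

/-- The null condition for constants `P^{γαβ}`. -/
def NullCond (P : Fin 3 → Fin 3 → Fin 3 → ℝ) : Prop :=
  ∀ ξ : Fin 3 → ℝ, ξ 0 ^ 2 = ξ 1 ^ 2 + ξ 2 ^ 2 →
    ∑ γ, ∑ α, ∑ β, P γ α β * ξ γ * ξ α * ξ β = 0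

/-- The symmetry condition `P^{γαβ} = P^{γβα}`. -/
def SymmCond (P : Fin 3 → Fin 3 → Fin 3 → ℝ) : Prop := ∀ γ α β, P γ α β = P γ β α

/-- Null form `N(w,z) = P^{γαβ} ∂_γ w ∂_α∂_β z`. -/
def Nform (P : Fin 3 → Fin 3 → Fin 3 → ℝ) (w z : Pt → ℝ) : Pt → ℝ :=
  fun p => ∑ γ, ∑ α, ∑ β, P γ α β * pd γ w p * pd α (pd β z) p

/-- The point of the hyperboloid `H_s` above `x ∈ ℝ²`. -/
def hypPt (s : ℝ) (x : Fin 2 → ℝ) : Pt :=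
  ![Real.sqrt (s ^ 2 + (x 0) ^ 2 + (x 1) ^ 2), x 0, x 1]

/-- `‖u‖_{L²_f(H_s)}`. -/
def L2H (u : Pt → ℝ) (s : ℝ) : ℝ :=
  (∫ x : Fin 2 → ℝ, (u (hypPt s x)) ^ 2) ^ (1 / 2 : ℝ)

/-- The hyperboloidal energy `E_m(u,s)`. -/
def Em (m : ℝ) (u : Pt → ℝ) (s : ℝ) : ℝ :=
  ∫ x : Fin 2 → ℝ,
    (((s / hypPt s x 0) * pd 0 u (hypPt s x)) ^ 2
      + ∑ a : Fin 2, (dund a u (hypPt s x)) ^ 2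
      + m ^ 2 * (u (hypPt s x)) ^ 2)

/-- `K₀ = s∂_s + 2x^a∂̲_a`, where `s∂_s = (s²/t)∂_t`. -/
def K0op (u : Pt → ℝ) : Pt → ℝ :=
  fun p => (sVar p) ^ 2 / p 0 * pd 0 u p + 2 * ∑ a : Fin 2, p a.succ * dund a u p

/-- The conformal energy `E_con(u,s)`. -/
def Econ (u : Pt → ℝ) (s : ℝ) : ℝ :=
  ∫ x : Fin 2 → ℝ,
    ((K0op u (hypPt s x) + u (hypPt s x)) ^ 2
      + ∑ a : Fin 2, (s * dund a u (hypPt s x)) ^ 2)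


/-! ### Polynomials in `1/t` and `x_a/t` -/

/-- Functions agreeing on `{t > 0}` with a real polynomial in `1/t`, `x₁/t` and `x₂/t`. -/
inductive ConePoly : (Pt → ℝ) → Prop
  | const (c : ℝ) : ConePoly fun _ => c
  | inv : ConePoly fun p => (p 0)⁻¹
  | ratio (a : Fin 2) : ConePoly fun p => p a.succ / p 0
  | add {f g : Pt → ℝ} : ConePoly f → ConePoly g → ConePoly fun p => f p + g p
  | mul {f g : Pt → ℝ} : ConePoly f → ConePoly g → ConePoly fun p => f p * g p
  | congr {f g : Pt → ℝ} : ConePoly f → (∀ p : Pt, 0 < p 0 → g p = f p) → ConePoly g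

namespace Cone

lemma two_le {p : Pt} (hp : p ∈ Cone) : 2 ≤ p 0 := hp.1

lemma time_pos {p : Pt} (hp : p ∈ Cone) : 0 < p 0 := by linarith [two_le hp]

lemma rad_lt {p : Pt} (hp : p ∈ Cone) : rad p < p 0 := by linarith [hp.2]

end Cone

lemma abs_succ_le_rad (p : Pt) (a : Fin 2) : |p a.succ| ≤ rad p := by
  apply Real.abs_le_sqrt
  fin_cases a
  · simpa using sq_nonneg (p 2)
  · simpa using sq_nonneg (p 1)

lemma eventually_time_pos {p : Pt} (hp : 0 < p 0) : ∀ᶠ q : Pt in 𝓝 p, 0 < q 0 :=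
  (continuous_apply 0).continuousAt.eventually (lt_mem_nhds hp)

lemma pd_add {f g : Pt → ℝ} {p : Pt} (hf : DifferentiableAt ℝ f p)
    (hg : DifferentiableAt ℝ g p) (i : Fin 3) :
    pd i (fun q => f q + g q) p = pd i f p + pd i g p := by
  simp [pd, fderiv_fun_add hf hg]

lemma pd_mul {f g : Pt → ℝ} {p : Pt} (hf : DifferentiableAt ℝ f p)
    (hg : DifferentiableAt ℝ g p) (i : Fin 3) :
    pd i (fun q => f q * g q) p = f p * pd i g p + pd i f p * g p := by
  simp [pd, fderiv_fun_mul hf hg, mul_comm]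

lemma pd_coord (i j : Fin 3) (p : Pt) : pd i (fun q => q j) p = e3 i j := by
  have h : HasFDerivAt (fun q : Pt => q j) (ContinuousLinearMap.proj j) p :=
    (ContinuousLinearMap.proj (R := ℝ) (φ := fun _ : Fin 3 => ℝ) j).hasFDerivAt
  simp [pd, h.fderiv]

lemma pd_inv {p : Pt} (hp : 0 < p 0) (i : Fin 3) :
    pd i (fun q => (q 0)⁻¹) p = -(e3 i 0) / p 0 ^ 2 := by
  have h : HasFDerivAt (fun q : Pt => q 0) (ContinuousLinearMap.proj 0) p :=
    (ContinuousLinearMap.proj (R := ℝ) (φ := fun _ : Fin 3 => ℝ) 0).hasFDerivAt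
  have h' := (hasDerivAt_inv hp.ne').comp_hasFDerivAt p h
  have h2 : fderiv ℝ (fun q : Pt => (q 0)⁻¹) p = _ := h'.fderiv
  simp [pd, h2]
  ring

lemma differentiableAt_time_inv {p : Pt} (hp : 0 < p 0) :
    DifferentiableAt ℝ (fun q : Pt => (q 0)⁻¹) p :=
  (differentiableAt_apply 0 p).fun_inv hp.ne'

lemma pd_ratio {p : Pt} (hp : 0 < p 0) (i : Fin 3) (a : Fin 2) :
    pd i (fun q => q a.succ / q 0) p
      = e3 i a.succ / p 0 - e3 i 0 * p a.succ / p 0 ^ 2 := by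
  simp only [div_eq_mul_inv]
  rw [pd_mul (differentiableAt_apply _ _) (differentiableAt_time_inv hp), pd_coord, pd_inv hp]
  ring

namespace ConePoly

lemma differentiableAt {f : Pt → ℝ} (hf : ConePoly f) {p : Pt} (hp : 0 < p 0) :
    DifferentiableAt ℝ f p := by
  induction hf with
  | const c => fun_prop
  | inv => exact differentiableAt_time_inv hp
  | ratio a =>
    simp only [div_eq_mul_inv]
    exact (differentiableAt_apply _ _).fun_mul (differentiableAt_time_inv hp)
  | add _ _ h₁ h₂ => exact h₁.fun_add h₂
  | mul _ _ h₁ h₂ => exact h₁.fun_mul h₂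
  | congr _ h ih => exact ih.congr_of_eventuallyEq ((eventually_time_pos hp).mono h)

lemma bounded {f : Pt → ℝ} (hf : ConePoly f) : ∃ C > (0 : ℝ), ∀ p ∈ Cone, |f p| ≤ C := by
  induction hf with
  | const c => exact ⟨|c| + 1, by positivity, fun p _ => by simp⟩
  | inv =>
    refine ⟨1, one_pos, fun p hp => ?_⟩
    rw [abs_of_pos (inv_pos.2 (Cone.time_pos hp))]
    exact inv_le_one_of_one_le₀ (by linarith [Cone.two_le hp])
  | ratio a =>
    refine ⟨1, one_pos, fun p hp => ?_⟩
    rw [abs_div, abs_of_pos (Cone.time_pos hp)]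
    exact div_le_one_of_le₀ ((abs_succ_le_rad p a).trans (Cone.rad_lt hp).le)
      (Cone.time_pos hp).le
  | add _ _ h₁ h₂ =>
    obtain ⟨C, hC, h₁⟩ := h₁
    obtain ⟨D, hD, h₂⟩ := h₂
    exact ⟨C + D, by positivity,
      fun p hp => (abs_add_le _ _).trans (add_le_add (h₁ p hp) (h₂ p hp))⟩
  | mul _ _ h₁ h₂ =>
    obtain ⟨C, hC, h₁⟩ := h₁
    obtain ⟨D, hD, h₂⟩ := h₂
    refine ⟨C * D, by positivity, fun p hp => ?_⟩
    rw [abs_mul]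
    exact mul_le_mul (h₁ p hp) (h₂ p hp) (abs_nonneg _) hC.le
  | congr _ h ih =>
    obtain ⟨C, hC, ih⟩ := ih
    exact ⟨C, hC, fun p hp => by rw [h p (Cone.time_pos hp)]; exact ih p hp⟩

lemma sum {ι : Type*} (s : Finset ι) {f : ι → Pt → ℝ} (hf : ∀ i ∈ s, ConePoly (f i)) :
    ConePoly fun p => ∑ i ∈ s, f i p := by
  classical
  induction s using Finset.induction_on with
  | empty => simpa using const 0
  | insert i s hi ih =>
    simp only [Finset.sum_insert hi]
    exact (hf i (by simp)).add (ih fun j hj => hf j (by simp [hj]))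

lemma time_mul_pd {f : Pt → ℝ} (hf : ConePoly f) (i : Fin 3) :
    ConePoly fun p => p 0 * pd i f p := by
  induction hf with
  | const c => exact (const 0).congr fun p _ => by simp [pd]
  | inv =>
    refine ((const (-(e3 i 0))).mul inv).congr fun p hp => ?_
    rw [pd_inv hp]
    field_simp
  | ratio a =>
    refine ((const (e3 i a.succ)).add ((const (-(e3 i 0))).mul (ratio a))).congr fun p hp => ?_
    rw [pd_ratio hp]
    field_simp
    ring
  | add hf hg h₁ h₂ =>
    refine (h₁.add h₂).congr fun p hp => ?_
    rw [pd_add (hf.differentiableAt hp) (hg.differentiableAt hp)]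
    ring
  | mul hf hg h₁ h₂ =>
    refine ((hf.mul h₂).add (h₁.mul hg)).congr fun p hp => ?_
    rw [pd_mul (hf.differentiableAt hp) (hg.differentiableAt hp)]
    ring
  | congr _ h ih =>
    refine ih.congr fun p hp => ?_
    have := Filter.EventuallyEq.fderiv_eq (𝕜 := ℝ) ((eventually_time_pos hp).mono h)
    simp [pd, this]

lemma pd {f : Pt → ℝ} (hf : ConePoly f) (i : Fin 3) : ConePoly (pd i f) :=
  (inv.mul (hf.time_mul_pd i)).congr fun p hp => by field_simp

lemma Lb {f : Pt → ℝ} (hf : ConePoly f) (a : Fin 2) : ConePoly (Lb a f) :=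
  (((ratio a).mul (hf.time_mul_pd 0)).add (hf.time_mul_pd a.succ)).congr fun p hp => by
    simp only [_root_.Lb]
    field_simp

lemma Gam {f : Pt → ℝ} (hf : ConePoly f) (k : Fin 5) : ConePoly (Gam k f) := by
  fin_cases k
  · exact hf.pd 0
  · exact hf.pd 1
  · exact hf.pd 2
  · exact hf.Lb 0
  · exact hf.Lb 1

lemma iterate_Gam {f : Pt → ℝ} (hf : ConePoly f) (k : Fin 5) (n : ℕ) :
    ConePoly ((_root_.Gam k)^[n] f) := by
  induction n with
  | zero => exact hf
  | succ n ih =>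
    rw [Function.iterate_succ_apply']
    exact ih.Gam k

lemma GamI {f : Pt → ℝ} (hf : ConePoly f) (I : Fin 5 → ℕ) : ConePoly (GamI I f) :=
  ((((hf.iterate_Gam 4 _).iterate_Gam 3 _).iterate_Gam 2 _).iterate_Gam 1 _).iterate_Gam 0 _

end ConePoly

/-! ### Multi-indices of length at most one -/

lemma GamI_zero (u : Pt → ℝ) : GamI 0 u = u := by simp [GamI]

lemma GamI_single (k : Fin 5) (u : Pt → ℝ) : GamI (Pi.single k 1) u = Gam k u := by
  fin_cases k <;> simp [GamI]

lemma mlen_single (k : Fin 5) : mlen (Pi.single k 1) = 1 := by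
  simp [mlen]

lemma single_mem_midxEq1 (k : Fin 5) : Pi.single k 1 ∈ midxEq1 := by
  simp only [midxEq1, Finset.mem_filter, Fintype.mem_piFinset, Finset.mem_range, mlen_single,
    and_true, Pi.single_apply]
  intro j
  split_ifs <;> simp

lemma single_mem_midxLe (k : Fin 5) : Pi.single k 1 ∈ midxLe 1 := by
  simp only [midxLe, Finset.mem_filter, Fintype.mem_piFinset, Finset.mem_range, mlen_single,
    le_refl, and_true, Pi.single_apply]
  intro j
  split_ifs <;> simp

lemma zero_mem_midxLe : 0 ∈ midxLe 1 := by
  rw [midxLe, Finset.mem_filter, Fintype.mem_piFinset]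
  simp [mlen]

/-! ### Combinations of `Γ^{I₁}v ∂_αΓ^{I₂}u` -/

/-- Bilinear operators of the form `Σ h^{I₁,I₂,α} Γ^{I₁}v ∂_αΓ^{I₂}u` with `|I₁| = 1`, `|I₂| ≤ 1`
and coefficients in `ConePoly`. -/
def IsGamCombination (T : (Pt → ℝ) → (Pt → ℝ) → Pt → ℝ) : Prop :=
  ∃ h : (Fin 5 → ℕ) → (Fin 5 → ℕ) → Fin 3 → Pt → ℝ,
    (∀ I₁ I₂ α, ConePoly (h I₁ I₂ α)) ∧
    ∀ u v : Pt → ℝ, ContDiff ℝ (⊤ : ℕ∞) u → ContDiff ℝ (⊤ : ℕ∞) v → ∀ p : Pt, 0 < p 0 →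
      T u v p = ∑ I₁ ∈ midxEq1, ∑ I₂ ∈ midxLe 1, ∑ α : Fin 3,
        h I₁ I₂ α p * GamI I₁ v p * pd α (GamI I₂ u) p

namespace IsGamCombination

variable {S T : (Pt → ℝ) → (Pt → ℝ) → Pt → ℝ}

lemma congr (hT : IsGamCombination T)
    (h : ∀ u v : Pt → ℝ, ContDiff ℝ (⊤ : ℕ∞) u → ContDiff ℝ (⊤ : ℕ∞) v → ∀ p : Pt, 0 < p 0 →
      S u v p = T u v p) : IsGamCombination S := by
  obtain ⟨H, hH, hT⟩ := hT
  exact ⟨H, hH, fun u v hu hv p hp => (h u v hu hv p hp).trans (hT u v hu hv p hp)⟩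

lemma zero : IsGamCombination fun _ _ _ => 0 :=
  ⟨fun _ _ _ _ => 0, fun _ _ _ => .const 0, fun _ _ _ _ _ _ => by simp⟩

lemma add (hS : IsGamCombination S) (hT : IsGamCombination T) :
    IsGamCombination fun u v p => S u v p + T u v p := by
  obtain ⟨G, hG, hS⟩ := hS
  obtain ⟨H, hH, hT⟩ := hT
  refine ⟨fun I₁ I₂ α p => G I₁ I₂ α p + H I₁ I₂ α p, fun I₁ I₂ α => (hG _ _ _).add (hH _ _ _),
    fun u v hu hv p hp => ?_⟩
  simp only [hS u v hu hv p hp, hT u v hu hv p hp, add_mul, Finset.sum_add_distrib]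

lemma smul {f : Pt → ℝ} (hf : ConePoly f) (hT : IsGamCombination T) :
    IsGamCombination fun u v p => f p * T u v p := by
  obtain ⟨H, hH, hT⟩ := hT
  refine ⟨fun I₁ I₂ α p => f p * H I₁ I₂ α p, fun I₁ I₂ α => hf.mul (hH _ _ _),
    fun u v hu hv p hp => ?_⟩
  simp only [hT u v hu hv p hp, Finset.mul_sum, mul_assoc]

lemma sum {ι : Type*} (s : Finset ι) {T : ι → (Pt → ℝ) → (Pt → ℝ) → Pt → ℝ}
    (hT : ∀ i ∈ s, IsGamCombination (T i)) :
    IsGamCombination fun u v p => ∑ i ∈ s, T i u v p := by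
  classical
  induction s using Finset.induction_on with
  | empty => simpa using zero
  | insert i s hi ih =>
    simp only [Finset.sum_insert hi]
    exact (hT i (by simp)).add (ih fun j hj => hT j (by simp [hj]))

lemma monomial {I₁ I₂ : Fin 5 → ℕ} (h₁ : I₁ ∈ midxEq1) (h₂ : I₂ ∈ midxLe 1) (α : Fin 3) :
    IsGamCombination fun u v p => GamI I₁ v p * pd α (GamI I₂ u) p := by
  refine ⟨fun J₁ J₂ β _ => if J₁ = I₁ then if J₂ = I₂ then if β = α then 1 else 0 else 0 else 0,
    fun _ _ _ => .const _, fun u v _ _ p _ => ?_⟩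
  rw [Finset.sum_eq_single_of_mem I₁ h₁ (fun J _ hJ => by simp [hJ]),
    Finset.sum_eq_single_of_mem I₂ h₂ (fun J _ hJ => by simp [hJ]),
    Finset.sum_eq_single_of_mem α (Finset.mem_univ α) (fun β _ hβ => by simp [hβ])]
  simp

lemma gam_pd (k : Fin 5) (α : Fin 3) :
    IsGamCombination fun u v p => Gam k v p * pd α u p := by
  simpa only [GamI_single, GamI_zero] using
    monomial (single_mem_midxEq1 k) zero_mem_midxLe α

lemma gam_pd_gam (k l : Fin 5) (α : Fin 3) :
    IsGamCombination fun u v p => Gam k v p * pd α (Gam l u) p := by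
  simpa only [GamI_single] using monomial (single_mem_midxEq1 k) (single_mem_midxLe l) α

end IsGamCombination

/-! ### Commuting derivatives and boosts -/

lemma ContDiff.pd {u : Pt → ℝ} (hu : ContDiff ℝ (⊤ : ℕ∞) u) (i : Fin 3) :
    ContDiff ℝ (⊤ : ℕ∞) (pd i u) :=
  (hu.fderiv_right (m := (⊤ : ℕ∞)) (by simp)).clm_apply contDiff_const

lemma pd_comm {u : Pt → ℝ} (hu : ContDiff ℝ (⊤ : ℕ∞) u) (i j : Fin 3) (p : Pt) :
    pd i (pd j u) p = pd j (pd i u) p := by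
  have hd : DifferentiableAt ℝ (fderiv ℝ u) p :=
    (hu.fderiv_right (m := (⊤ : ℕ∞)) (by simp)).differentiable (by simp) p
  have key : ∀ i j : Fin 3, pd i (pd j u) p = fderiv ℝ (fderiv ℝ u) p (e3 i) (e3 j) := by
    intro i j
    change fderiv ℝ (fun q => fderiv ℝ u q (e3 j)) p (e3 i) = _
    rw [fderiv_clm_apply hd (differentiableAt_const _)]
    simp
  rw [key, key]
  exact (hu.contDiffAt.isSymmSndFDerivAt (by
    simpa using WithTop.coe_le_coe.2 (le_top : (2 : ℕ∞) ≤ ⊤))) _ _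

lemma pd_Lb {u : Pt → ℝ} (hu : ContDiff ℝ (⊤ : ℕ∞) u) (a : Fin 2) (i : Fin 3) (p : Pt) :
    pd i (Lb a u) p = Lb a (pd i u) p + e3 i a.succ * pd 0 u p + e3 i 0 * pd a.succ u p := by
  have hd : ∀ j, DifferentiableAt ℝ (pd j u) p := fun j => (hu.pd j).differentiable (by simp) p
  have hc : ∀ j, DifferentiableAt ℝ (fun q : Pt => q j) p := fun j => differentiableAt_apply j p
  unfold Lb
  rw [pd_add ((hc _).fun_mul (hd _)) ((hc _).fun_mul (hd _)), pd_mul (hc _) (hd _),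
    pd_mul (hc _) (hd _), pd_coord, pd_coord, pd_comm hu i 0, pd_comm hu i a.succ]
  ring

/-! ### The hyperboloidal frame -/

/-- The covector `(1, -x₁/t, -x₂/t)`. -/
def frameCov (i : Fin 3) (p : Pt) : ℝ := if i = 0 then 1 else -(p i / p 0)

/-- `t(∂_i − frameCov_i ∂_t)`: zero for `i = 0` and the boost `L_a` for `i = a`. -/
def frameBoost (i : Fin 3) (u : Pt → ℝ) (p : Pt) : ℝ :=
  p 0 * (pd i u p - frameCov i p * pd 0 u p)

lemma frameBoost_zero (u : Pt → ℝ) (p : Pt) : frameBoost 0 u p = 0 := by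
  simp [frameBoost, frameCov]

lemma frameBoost_succ (a : Fin 2) (u : Pt → ℝ) {p : Pt} (hp : 0 < p 0) :
    frameBoost a.succ u p = Lb a u p := by
  simp only [frameBoost, frameCov, Lb, Fin.succ_ne_zero, if_false]
  field_simp
  ring

lemma ConePoly.frameCov (i : Fin 3) : ConePoly (frameCov i) := by
  refine Fin.cases ?_ (fun a => ?_) i
  · exact (const 1).congr fun p _ => by simp [_root_.frameCov]
  · exact ((const (-1)).mul (ratio a)).congr fun p _ => by simp [_root_.frameCov]

lemma Lb_eq_Gam (a : Fin 2) : Lb a = Gam (Fin.natAdd 3 a) := by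
  fin_cases a <;> rfl

lemma pd_eq_Gam (i : Fin 3) : pd i = Gam (Fin.castAdd 2 i) := by
  fin_cases i <;> rfl

lemma isGamCombination_frameBoost_pd (γ α β : Fin 3) :
    IsGamCombination fun u v p => frameBoost γ v p * pd α (pd β u) p := by
  refine Fin.cases ?_ (fun a => ?_) γ
  · exact IsGamCombination.zero.congr fun u v _ _ p _ => by simp [frameBoost_zero]
  · exact (IsGamCombination.gam_pd_gam (Fin.natAdd 3 a) (Fin.castAdd 2 β) α).congr
      fun u v _ _ p hp => by rw [frameBoost_succ a v hp, Lb_eq_Gam, pd_eq_Gam β]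

lemma isGamCombination_pd_frameBoost (α β : Fin 3) :
    IsGamCombination fun u v p => pd 0 v p * frameBoost α (pd β u) p := by
  refine Fin.cases ?_ (fun a => ?_) α
  · exact IsGamCombination.zero.congr fun u v _ _ p _ => by simp [frameBoost_zero]
  · refine ((IsGamCombination.gam_pd_gam 0 (Fin.natAdd 3 a) β).add
      (((IsGamCombination.gam_pd 0 0).smul (.const (-(e3 β a.succ)))).add
        ((IsGamCombination.gam_pd 0 a.succ).smul (.const (-(e3 β 0)))))).congr
      fun u v hu _ p hp => ?_
    rw [frameBoost_succ a _ hp, ← Lb_eq_Gam, pd_Lb hu, show Gam 0 = pd 0 from rfl]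
    ring

/-- The cubic form of `P` evaluated on `frameCov`. -/
def frameCubic (P : Fin 3 → Fin 3 → Fin 3 → ℝ) (p : Pt) : ℝ :=
  ∑ γ, ∑ α, ∑ β, P γ α β * frameCov γ p * frameCov α p * frameCov β p

lemma ConePoly.frameCubic (P : Fin 3 → Fin 3 → Fin 3 → ℝ) : ConePoly (frameCubic P) :=
  .sum _ fun γ _ => .sum _ fun α _ => .sum _ fun β _ =>
    (((const (P γ α β)).mul (.frameCov γ)).mul (.frameCov α)).mul (.frameCov β)

lemma isGamCombination_Nform_sub (P : Fin 3 → Fin 3 → Fin 3 → ℝ) :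
    IsGamCombination fun u v p =>
      p 0 * (Nform P v u p - frameCubic P p * pd 0 v p * pd 0 (pd 0 u) p) := by
  refine (IsGamCombination.sum Finset.univ fun γ _ => .sum Finset.univ fun α _ =>
    .sum Finset.univ fun β _ => ((((isGamCombination_frameBoost_pd γ α β).add
      ((isGamCombination_pd_frameBoost α β).smul (.frameCov γ))).add
      ((isGamCombination_pd_frameBoost β 0).smul
        ((ConePoly.frameCov γ).mul (.frameCov α)))).smul (.const (P γ α β)))).congr
    fun u v hu hv p hp => ?_
  simp only [Nform, frameCubic, Finset.sum_mul, ← Finset.sum_sub_distrib, Finset.mul_sum]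
  refine Finset.sum_congr rfl fun γ _ => Finset.sum_congr rfl fun α _ =>
    Finset.sum_congr rfl fun β _ => ?_
  simp only [frameBoost]
  rw [pd_comm hu 0 β]
  ring

/-! ### The null condition -/

lemma abs_mul_mul_sub_le {a b c a' b' c' δ : ℝ} (ha : |a| ≤ 1) (hb : |b| ≤ 1)
    (hb' : |b'| ≤ 1) (hc' : |c'| ≤ 1) (hda : |a - a'| ≤ δ) (hdb : |b - b'| ≤ δ)
    (hdc : |c - c'| ≤ δ) : |a * b * c - a' * b' * c'| ≤ 3 * δ := by
  have hδ : 0 ≤ δ := (abs_nonneg _).trans hda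
  have h₁ : |a * b * (c - c')| ≤ 1 * 1 * δ := by
    rw [abs_mul, abs_mul]; gcongr
  have h₂ : |a * (b - b') * c'| ≤ 1 * δ * 1 := by
    rw [abs_mul, abs_mul]; gcongr
  have h₃ : |(a - a') * b' * c'| ≤ δ * 1 * 1 := by
    rw [abs_mul, abs_mul]; gcongr
  calc |a * b * c - a' * b' * c'|
      = |a * b * (c - c') + a * (b - b') * c' + (a - a') * b' * c'| := by congr 1; ring
    _ ≤ |a * b * (c - c')| + |a * (b - b') * c'| + |(a - a') * b' * c'| := abs_add_three _ _ _
    _ ≤ 3 * δ := by linarith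

lemma NullCond.abs_frameCubic_le {P : Fin 3 → Fin 3 → Fin 3 → ℝ} (hP : NullCond P) {p : Pt}
    (hp : p ∈ Cone) :
    |frameCubic P p| ≤ (∑ γ, ∑ α, ∑ β, |P γ α β|) * (3 * ((sVar p) ^ 2 / (p 0) ^ 2)) := by
  have ht := Cone.time_pos hp
  set ρ : ℝ := rad p / p 0 with hρ
  have hρ0 : 0 ≤ ρ := div_nonneg (Real.sqrt_nonneg _) ht.le
  have hρ1 : ρ ≤ 1 := div_le_one_of_le₀ (Cone.rad_lt hp).le ht.le
  have hrad : rad p ^ 2 = p 1 ^ 2 + p 2 ^ 2 := Real.sq_sqrt (by positivity)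
  have hs : sVar p ^ 2 / p 0 ^ 2 = 1 - ρ ^ 2 := by
    have : 0 ≤ p 0 ^ 2 - p 1 ^ 2 - p 2 ^ 2 := by
      have := pow_le_pow_left₀ (Real.sqrt_nonneg _) (Cone.rad_lt hp).le 2
      change rad p ^ 2 ≤ _ at this
      linarith
    rw [sVar, Real.sq_sqrt this, hρ, div_pow, hrad]
    field_simp
    ring
  -- the null covector obtained by moving the time component of `frameCov` to the light cone
  set ξ : Fin 3 → ℝ := fun i => if i = 0 then ρ else frameCov i p with hξ
  have hnull : ∑ γ, ∑ α, ∑ β, P γ α β * ξ γ * ξ α * ξ β = 0 := by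
    apply hP
    simp only [hξ, frameCov, hρ]
    simp [div_pow, hrad, add_div]
  have hcov : ∀ i, |frameCov i p| ≤ 1 := by
    refine Fin.cases (by simp [frameCov]) fun a => ?_
    simp only [frameCov, Fin.succ_ne_zero, if_false, abs_neg, abs_div, abs_of_pos ht]
    exact div_le_one_of_le₀ ((abs_succ_le_rad p a).trans (Cone.rad_lt hp).le) ht.le
  have hξ1 : ∀ i, |ξ i| ≤ 1 := by
    intro i
    by_cases hi : i = 0
    · simpa [hξ, hi, abs_of_nonneg hρ0] using hρ1
    · simpa [hξ, hi] using hcov i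
  have hdiff : ∀ i, |frameCov i p - ξ i| ≤ 1 - ρ ^ 2 := by
    intro i
    by_cases hi : i = 0
    · simp only [hξ, hi, frameCov, if_true, abs_of_nonneg (sub_nonneg.2 hρ1)]
      nlinarith
    · simp only [hξ, hi, if_false, sub_self, abs_zero]
      nlinarith
  rw [hs, ← sub_zero (frameCubic P p), ← hnull, frameCubic]
  simp only [← Finset.sum_sub_distrib, Finset.sum_mul]
  refine (Finset.abs_sum_le_sum_abs _ _).trans (Finset.sum_le_sum fun γ _ => ?_)
  refine (Finset.abs_sum_le_sum_abs _ _).trans (Finset.sum_le_sum fun α _ => ?_)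
  refine (Finset.abs_sum_le_sum_abs _ _).trans (Finset.sum_le_sum fun β _ => ?_)
  rw [show P γ α β * frameCov γ p * frameCov α p * frameCov β p - P γ α β * ξ γ * ξ α * ξ β
    = P γ α β * (frameCov γ p * frameCov α p * frameCov β p - ξ γ * ξ α * ξ β) by ring, abs_mul]
  exact mul_le_mul_of_nonneg_left (abs_mul_mul_sub_le (hcov _) (hcov _) (hξ1 _) (hξ1 _)
    (hdiff _) (hdiff _) (hdiff _)) (abs_nonneg _)

lemma abs_pd_le_pdNorm (α : Fin 3) (u : Pt → ℝ) (p : Pt) : |pd α u p| ≤ pdNorm u p :=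
  Real.abs_le_sqrt (Finset.single_le_sum (f := fun α => pd α u p ^ 2)
    (fun _ _ => sq_nonneg _) (Finset.mem_univ α))

/-- decomposition and estimate of the null form `P^{γαβ}∂_γv ∂_α∂_βu`. -/
theorem nullform_decomposition
    (P : Fin 3 → Fin 3 → Fin 3 → ℝ) (hP : NullCond P) :
    ∃ g : Pt → ℝ, ∃ h : (Fin 5 → ℕ) → (Fin 5 → ℕ) → Fin 3 → Pt → ℝ,
      (∃ C > (0:ℝ), ∀ p ∈ Cone, |g p| ≤ C * (sVar p) ^ 2 / (p 0) ^ 2) ∧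
      (∀ I : Fin 5 → ℕ, ∃ C > (0:ℝ), ∀ p ∈ Cone, |GamI I g p| ≤ C) ∧
      (∀ I I₁ I₂ : Fin 5 → ℕ, ∀ α : Fin 3,
        ∃ C > (0:ℝ), ∀ p ∈ Cone, |GamI I (h I₁ I₂ α) p| ≤ C) ∧
      (∀ u v : Pt → ℝ,
        ContDiff ℝ (⊤ : ℕ∞) u → ContDiff ℝ (⊤ : ℕ∞) v →
        Function.support u ⊆ Cone → Function.support v ⊆ Cone →
        ∀ p ∈ Cone,
          Nform P v u p =
            g p * pd 0 v p * pd 0 (pd 0 u) p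
              + (1 / p 0) * ∑ I₁ ∈ midxEq1, ∑ I₂ ∈ midxLe 1, ∑ α : Fin 3,
                  h I₁ I₂ α p * GamI I₁ v p * pd α (GamI I₂ u) p) ∧
      (∃ C > (0:ℝ), ∀ u v : Pt → ℝ,
        ContDiff ℝ (⊤ : ℕ∞) u → ContDiff ℝ (⊤ : ℕ∞) v →
        Function.support u ⊆ Cone → Function.support v ⊆ Cone →
        ∀ p ∈ Cone,
          |Nform P v u p| ≤
            C * ((sVar p) ^ 2 / (p 0) ^ 2 * |pd 0 v p * pd 0 (pd 0 u) p|
              + (1 / p 0) * ∑ I₁ ∈ midxEq1, ∑ I₂ ∈ midxLe 1,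
                  |GamI I₁ v p| * pdNorm (GamI I₂ u) p)) := by
  obtain ⟨h, hh, hdec⟩ := isGamCombination_Nform_sub P
  have hdecomp : ∀ u v : Pt → ℝ, ContDiff ℝ (⊤ : ℕ∞) u → ContDiff ℝ (⊤ : ℕ∞) v → ∀ p ∈ Cone,
      Nform P v u p = frameCubic P p * pd 0 v p * pd 0 (pd 0 u) p
        + (1 / p 0) * ∑ I₁ ∈ midxEq1, ∑ I₂ ∈ midxLe 1, ∑ α : Fin 3,
            h I₁ I₂ α p * GamI I₁ v p * pd α (GamI I₂ u) p := by
    intro u v hu hv p hp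
    have ht := Cone.time_pos hp
    rw [← hdec u v hu hv p ht]
    field_simp
    ring
  choose B hB0 hB using fun I₁ I₂ α => (hh I₁ I₂ α).bounded
  set A : ℝ := (∑ γ, ∑ α, ∑ β, |P γ α β|) * 3 + 1 with hA
  have hA0 : 0 < A := by positivity
  have hg : ∀ p ∈ Cone, |frameCubic P p| ≤ A * ((sVar p) ^ 2 / (p 0) ^ 2) := by
    intro p hp
    have : 0 ≤ (sVar p) ^ 2 / (p 0) ^ 2 := by positivity
    rw [hA, add_mul, mul_assoc]
    linarith [hP.abs_frameCubic_le hp]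
  refine ⟨frameCubic P, h, ⟨A, hA0, fun p hp => (hg p hp).trans_eq (mul_div_assoc _ _ _).symm⟩,
    fun I => ((ConePoly.frameCubic P).GamI I).bounded,
    fun I I₁ I₂ α => ((hh I₁ I₂ α).GamI I).bounded,
    fun u v hu hv _ _ => hdecomp u v hu hv, ?_⟩
  set M : ℝ := ∑ I₁ ∈ midxEq1, ∑ I₂ ∈ midxLe 1, ∑ α : Fin 3, B I₁ I₂ α with hM
  have hM0 : 0 ≤ M := Finset.sum_nonneg fun _ _ => Finset.sum_nonneg fun _ _ =>
    Finset.sum_nonneg fun _ _ => (hB0 _ _ _).le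
  refine ⟨A + M, by positivity, fun u v hu hv _ _ p hp => ?_⟩
  have ht := Cone.time_pos hp
  have hBM : ∀ I₁ ∈ midxEq1, ∀ I₂ ∈ midxLe 1, ∑ α : Fin 3, B I₁ I₂ α ≤ M := by
    intro I₁ h₁ I₂ h₂
    refine (Finset.single_le_sum (f := fun I₂ => ∑ α : Fin 3, B I₁ I₂ α) (fun _ _ =>
      Finset.sum_nonneg fun _ _ => (hB0 _ _ _).le) h₂).trans ?_
    exact Finset.single_le_sum (f := fun I₁ => ∑ I₂ ∈ midxLe 1, ∑ α : Fin 3, B I₁ I₂ α)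
      (fun _ _ => Finset.sum_nonneg fun _ _ => Finset.sum_nonneg fun _ _ => (hB0 _ _ _).le) h₁
  have hrem : |∑ I₁ ∈ midxEq1, ∑ I₂ ∈ midxLe 1, ∑ α : Fin 3,
      h I₁ I₂ α p * GamI I₁ v p * pd α (GamI I₂ u) p|
      ≤ M * ∑ I₁ ∈ midxEq1, ∑ I₂ ∈ midxLe 1, |GamI I₁ v p| * pdNorm (GamI I₂ u) p := by
    simp only [Finset.mul_sum]
    refine (Finset.abs_sum_le_sum_abs _ _).trans (Finset.sum_le_sum fun I₁ h₁ => ?_)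
    refine (Finset.abs_sum_le_sum_abs _ _).trans (Finset.sum_le_sum fun I₂ h₂ => ?_)
    have hn : 0 ≤ pdNorm (GamI I₂ u) p := Real.sqrt_nonneg _
    refine (Finset.abs_sum_le_sum_abs _ _).trans ((Finset.sum_le_sum
      (g := fun α => B I₁ I₂ α * (|GamI I₁ v p| * pdNorm (GamI I₂ u) p)) fun α _ => ?_).trans ?_)
    · rw [abs_mul, abs_mul, mul_assoc]
      have := hB I₁ I₂ α p hp
      have := abs_pd_le_pdNorm α (GamI I₂ u) p
      have := (hB0 I₁ I₂ α).le
      gcongr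
    · rw [← Finset.sum_mul]
      exact mul_le_mul_of_nonneg_right (hBM I₁ h₁ I₂ h₂) (by positivity)
  set X : ℝ := |pd 0 v p * pd 0 (pd 0 u) p|
  set Y : ℝ := ∑ I₁ ∈ midxEq1, ∑ I₂ ∈ midxLe 1, |GamI I₁ v p| * pdNorm (GamI I₂ u) p with hY
  have hY0 : 0 ≤ Y := Finset.sum_nonneg fun _ _ => Finset.sum_nonneg fun _ _ =>
    mul_nonneg (abs_nonneg _) (Real.sqrt_nonneg _)
  have h₁ : |frameCubic P p * pd 0 v p * pd 0 (pd 0 u) p|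
      ≤ A * ((sVar p) ^ 2 / (p 0) ^ 2) * X := by
    rw [mul_assoc, abs_mul]
    exact mul_le_mul_of_nonneg_right (hg p hp) (abs_nonneg _)
  have h₂ : |1 / p 0 * ∑ I₁ ∈ midxEq1, ∑ I₂ ∈ midxLe 1, ∑ α : Fin 3,
      h I₁ I₂ α p * GamI I₁ v p * pd α (GamI I₂ u) p| ≤ 1 / p 0 * (M * Y) := by
    rw [abs_mul, abs_of_pos (one_div_pos.2 ht)]
    exact mul_le_mul_of_nonneg_left hrem (one_div_pos.2 ht).le
  rw [hdecomp u v hu hv p hp]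
  have h₃ : 0 ≤ M * ((sVar p) ^ 2 / (p 0) ^ 2 * X) := by positivity
  have h₄ : 0 ≤ A * (1 / p 0 * Y) := by positivity
  linarith [abs_add_le (frameCubic P p * pd 0 v p * pd 0 (pd 0 u) p)
    (1 / p 0 * ∑ I₁ ∈ midxEq1, ∑ I₂ ∈ midxLe 1, ∑ α : Fin 3,
      h I₁ I₂ α p * GamI I₁ v p * pd α (GamI I₂ u) p)]
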